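/- Let (U,S) be an instance of Exact 3-Set Cover with |U|=3k, |S|=m and 1 ≤ k ≤ m, and let M be the multilayer network constructed from it as described, with evader v̂, contacts F = U ∪ W, degree centrality, and safety margins d^{α_i} = 3 for every layer α_i. Then S contains k pairwise disjoint sets whose union is U if and only if this instance of Multilayer Local Hiding has a solution, i.e., there is an admissible edge set A* joining v̂ to every contact in at least one layer such that in every layer α_i of the resulting network at least 3 nodes have degree in layer α_i strictly greater than the degree of v̂ in layer α_i. -/

import Mathlib

open scoped Classical ENNReal

/-- A multilayer network: `occ v α` means node `v` occurs in layer `α`;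
`Edge` is the edge relation on occurrences. -/
structure MLNet (V : Type*) (L : Type*) where
  occ : V → L → Prop
  Edge : V × L → V × L → Prop

namespace MLNet

variable {V : Type*} {L : Type*}

/-- The axioms of a multilayer network with diagonal couplings: the edge relation is
symmetric, has no self-loops, joins only occurrences, and inter-layer edges join
two occurrences of the same node. -/
def IsValid (M : MLNet V L) : Prop :=
  (∀ a b, M.Edge a b → M.Edge b a) ∧
  (∀ a, ¬ M.Edge a a) ∧
  (∀ a b, M.Edge a b → M.occ a.1 a.2 ∧ M.occ b.1 b.2) ∧
  (∀ a b, M.Edge a b → a.2 ≠ b.2 → a.1 = b.1)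

/-- The simple graph on occurrences given by the (symmetrized) edge relation. -/
def flat (M : MLNet V L) : SimpleGraph (V × L) := SimpleGraph.fromRel M.Edge

/-- Global degree centrality: the number of nodes `w ≠ v` such that some edge joins an
occurrence of `v` and an occurrence of `w`. -/
noncomputable def degGlobal (M : MLNet V L) (v : V) : ℕ :=
  {w : V | w ≠ v ∧ ∃ α β, M.Edge (v, α) (w, β) ∨ M.Edge (w, β) (v, α)}.ncard

/-- Multilayer distance: the least length of a path from an occurrence of `v` to an
occurrence of `w` (`⊤` if there is none). -/
noncomputable def mdist (M : MLNet V L) (v w : V) : ℕ∞ :=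
  ⨅ (α : L) (β : L) (_ : M.occ v α) (_ : M.occ w β), M.flat.edist (v, α) (w, β)

/-- Global closeness centrality, valued in `ℝ≥0∞` (so that `1/∞ = 0`). -/
noncomputable def closGlobal (M : MLNet V L) [Fintype V] (v : V) : ℝ≥0∞ :=
  ∑ w ∈ Finset.univ.filter (fun w => w ≠ v), ((M.mdist v w : ℝ≥0∞))⁻¹

variable [Fintype V] [Fintype L]

/-- The number of shortest multilayer paths between nodes `w` and `u`
(`0` if they are not connected). -/
noncomputable def numSP (M : MLNet V L) (w u : V) : ℕ :=
  ∑ α : L, ∑ β : L,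
    if M.occ w α ∧ M.occ u β then
      (M.flat.finsetWalkLength (M.mdist w u).toNat (w, α) (u, β)).card
    else 0

/-- The number of pairs `(v^γ, p)` where `p` is a shortest multilayer path between `w` and `u`
passing through the occurrence `v^γ`. -/
noncomputable def numSPthrough (M : MLNet V L) (v w u : V) : ℕ :=
  ∑ α : L, ∑ β : L,
    if M.occ w α ∧ M.occ u β then
      ∑ p ∈ M.flat.finsetWalkLength (M.mdist w u).toNat (w, α) (u, β),
        (Finset.univ.filter (fun γ : L => (v, γ) ∈ p.support)).card
    else 0

/-- Global betweenness centrality: the sum over unordered pairs `{w,u}` of connected nodes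
(distinct from `v`) of the fraction of shortest multilayer paths passing through an
occurrence of `v` (division by zero, for unconnected pairs, gives `0`). -/
noncomputable def betwGlobal (M : MLNet V L) (v : V) : ℝ :=
  (1 / 2) * ∑ w : V, ∑ u : V,
    if w ≠ v ∧ u ≠ v ∧ w ≠ u then (M.numSPthrough v w u : ℝ) / (M.numSP w u : ℝ) else 0

/-- The simple graph `G^α` of a single layer (nodes not occurring in `α` are isolated). -/
def layerGraph (M : MLNet V L) (α : L) : SimpleGraph V :=
  SimpleGraph.fromRel (fun v w => M.Edge (v, α) (w, α))

/-- Degree of a node in the graph of layer `α`. -/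
noncomputable def layerDeg (M : MLNet V L) (α : L) (v : V) : ℕ :=
  ((M.layerGraph α).neighborSet v).ncard

end MLNet

/-- `Admissible M ve F A`: `A` encodes a set of intra-layer edges joining the evader `ve`
to contacts; `(v, α) ∈ A` encodes the edge `(ve^α, v^α)`, which requires `v ∈ F` and
both `ve` and `v` to occur in layer `α`. -/
def Admissible {V L : Type*} (M : MLNet V L) (ve : V) (F : Set V) (A : Set (V × L)) : Prop :=
  ∀ p ∈ A, p.1 ∈ F ∧ M.occ ve p.2 ∧ M.occ p.1 p.2

/-- The network obtained from `M` by adding, for each `(v, α) ∈ A`, the edge `(ve^α, v^α)`. -/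
def MLNet.addEdges {V L : Type*} (M : MLNet V L) (ve : V) (A : Set (V × L)) : MLNet V L where
  occ := M.occ
  Edge a b := M.Edge a b ∨
    ∃ p ∈ A, (a = (ve, p.2) ∧ b = (p.1, p.2)) ∨ (b = (ve, p.2) ∧ a = (p.1, p.2))

/-- `A` joins the evader to every contact in at least one layer. -/
def ConnectsAll {V L : Type*} (F : Set V) (A : Set (V × L)) : Prop :=
  ∀ v ∈ F, ∃ α, (v, α) ∈ A

section SG

variable {V : Type*} [Fintype V]

/-- Closeness centrality in a simple graph, valued in `ℝ≥0∞` (so that `1/∞ = 0`). -/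
noncomputable def closSG (G : SimpleGraph V) (v : V) : ℝ≥0∞ :=
  ∑ w ∈ Finset.univ.filter (fun w => w ≠ v), ((G.edist v w : ℝ≥0∞))⁻¹

/-- The number of shortest paths between `w` and `u` in a simple graph
(`0` if they are not connected and distinct). -/
noncomputable def numSPsg (G : SimpleGraph V) (w u : V) : ℕ :=
  (G.finsetWalkLength (G.edist w u).toNat w u).card

/-- The number of shortest paths between `w` and `u` passing through `v`. -/
noncomputable def numSPsgThrough (G : SimpleGraph V) (v w u : V) : ℕ :=
  ((G.finsetWalkLength (G.edist w u).toNat w u).filter (fun p => v ∈ p.support)).card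

/-- Betweenness centrality in a simple graph: the sum over unordered pairs `{w,u}` of
connected vertices distinct from `v` of the fraction of shortest paths through `v`. -/
noncomputable def betwSG (G : SimpleGraph V) (v : V) : ℝ :=
  (1 / 2) * ∑ w : V, ∑ u : V,
    if w ≠ v ∧ u ≠ v ∧ w ≠ u then (numSPsgThrough G v w u : ℝ) / (numSPsg G w u : ℝ) else 0

end SG

namespace Stmt4

/-- Nodes of the gadget network: the universe `U` (indexed by `Fin (3k)`), the contacts
`W` (indexed by `Fin (2(m-k))`), the three nodes `a₁,a₂,a₃`, and the evader. -/
inductive Node (k m : ℕ) where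
  | u : Fin (3 * k) → Node k m
  | w : Fin (2 * (m - k)) → Node k m
  | a : Fin 3 → Node k m
  | ve : Node k m
deriving DecidableEq, Fintype

variable {k m : ℕ}

/-- Occurrences: `u j` occurs in layer `αᵢ` iff `j ∈ S i`; all other nodes occur in
every layer. -/
def occ (S : Fin m → Finset (Fin (3 * k))) : Node k m → Fin m → Prop
  | .u j, i => j ∈ S i
  | _, _ => True

/-- Edges: in every layer `αᵢ`, every occurring `u j` is joined to each of `a₁,a₂,a₃`;
there are no other edges. -/
def edge (S : Fin m → Finset (Fin (3 * k))) :
    Node k m × Fin m → Node k m × Fin m → Prop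
  | (.u j, i), (.a _, i') => i = i' ∧ j ∈ S i
  | _, _ => False

/-- The gadget multilayer network constructed from the Exact 3-Set Cover instance `S`. -/
def M (S : Fin m → Finset (Fin (3 * k))) : MLNet (Node k m) (Fin m) where
  occ := occ S
  Edge := edge S

/-- The contacts: all of `U ∪ W`. -/
def F : Set (Node k m) :=
  {x | (∃ j, x = Node.u j) ∨ (∃ j, x = Node.w j)}

end Stmt4

namespace Stmt4

variable {k m : ℕ} (S : Fin m → Finset (Fin (3 * k))) {A : Set (Node k m × Fin m)}

theorem layerGraph_adj_ve (hA : Admissible (M S) Node.ve F A) (i : Fin m) (z : Node k m) :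
    (((M S).addEdges Node.ve A).layerGraph i).Adj Node.ve z ↔ (z, i) ∈ A := by
  have hve : ∀ p ∈ A, p.1 ≠ Node.ve := fun p hp h => by
    have := (hA p hp).1
    simp [F, h] at this
  simp only [MLNet.layerGraph, SimpleGraph.fromRel_adj, MLNet.addEdges, M]
  constructor
  · rintro ⟨hne, (h | ⟨p, hp, h⟩) | (h | ⟨p, hp, h⟩)⟩
    · simp [edge] at h
    · simp only [Prod.mk.injEq] at h
      rcases h with ⟨-, rfl, rfl⟩ | ⟨⟨rfl, -⟩, h, -⟩
      · exact hp
      · exact absurd rfl hne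
    · cases z <;> simp [edge] at h
    · simp only [Prod.mk.injEq] at h
      rcases h with ⟨⟨rfl, -⟩, h, -⟩ | ⟨-, rfl, rfl⟩
      · exact absurd rfl hne
      · exact hp
  · intro h
    exact ⟨(hve _ h).symm, Or.inl (Or.inr ⟨(z, i), h, Or.inl ⟨rfl, rfl⟩⟩)⟩

theorem layerGraph_adj_of_ne_ve (i : Fin m) {y z : Node k m}
    (hy : y ≠ Node.ve) (hz : z ≠ Node.ve) :
    (((M S).addEdges Node.ve A).layerGraph i).Adj y z ↔
      edge S (y, i) (z, i) ∨ edge S (z, i) (y, i) := by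
  simp only [MLNet.layerGraph, SimpleGraph.fromRel_adj, MLNet.addEdges, M, Prod.mk.injEq, hy, hz,
    false_and, or_self, and_false, exists_false, or_false]
  refine and_iff_right_of_imp ?_
  rintro h rfl
  cases y <;> simp [edge] at h

theorem layerDeg_a (hA : Admissible (M S) Node.ve F A) (i : Fin m) (b : Fin 3) :
    ((M S).addEdges Node.ve A).layerDeg i (Node.a b) = (S i).card := by
  have : (((M S).addEdges Node.ve A).layerGraph i).neighborSet (Node.a b) =
      Node.u '' (S i : Set (Fin (3 * k))) := by
    ext z
    rw [SimpleGraph.mem_neighborSet]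
    by_cases hz : z = Node.ve
    · subst hz
      rw [SimpleGraph.adj_comm, layerGraph_adj_ve S hA]
      simp only [Set.mem_image, reduceCtorEq, and_false, exists_false, iff_false]
      intro h
      have := (hA _ h).1
      simp [F] at this
    · rw [layerGraph_adj_of_ne_ve S i (by simp) hz]
      cases z <;> simp [edge]
  rw [MLNet.layerDeg, this, Set.ncard_image_of_injective _ fun _ _ h => Node.u.inj h,
    Set.ncard_coe_finset]

theorem layerDeg_w_le_one (i : Fin m) (l : Fin (2 * (m - k))) :
    ((M S).addEdges Node.ve A).layerDeg i (Node.w l) ≤ 1 := by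
  have : (((M S).addEdges Node.ve A).layerGraph i).neighborSet (Node.w l) ⊆ {Node.ve} := by
    intro z hz
    rw [SimpleGraph.mem_neighborSet] at hz
    by_contra hne
    rw [layerGraph_adj_of_ne_ve S i (by simp) hne] at hz
    cases z <;> simp [edge] at hz
  exact (Set.ncard_le_ncard this).trans (Set.ncard_singleton _).le

theorem layerDeg_u (hA : Admissible (M S) Node.ve F A) {i : Fin m} {j : Fin (3 * k)}
    (hj : j ∈ S i) :
    ((M S).addEdges Node.ve A).layerDeg i (Node.u j) = if (Node.u j, i) ∈ A then 4 else 3 := by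
  have ha : (Set.range (Node.a : Fin 3 → Node k m)).ncard = 3 := by
    rw [← Set.image_univ, Set.ncard_image_of_injective _ fun _ _ h => Node.a.inj h,
      Set.ncard_univ, Nat.card_fin]
  have : (((M S).addEdges Node.ve A).layerGraph i).neighborSet (Node.u j) =
      if (Node.u j, i) ∈ A then insert Node.ve (Set.range Node.a) else Set.range Node.a := by
    ext z
    rw [SimpleGraph.mem_neighborSet]
    by_cases hz : z = Node.ve
    · subst hz
      rw [SimpleGraph.adj_comm, layerGraph_adj_ve S hA]
      split_ifs with h <;> simp [h]
    · rw [layerGraph_adj_of_ne_ve S i (by simp) hz]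
      split_ifs <;> cases z <;> simp_all [edge]
  rw [MLNet.layerDeg, this]
  split_ifs
  · rw [Set.ncard_insert_of_notMem (by simp), ha]
  · exact ha

variable (A) in
/-- The universe elements joined to the evader in layer `i`. -/
noncomputable def joinedU (i : Fin m) : Finset (Fin (3 * k)) :=
  Finset.univ.filter fun j => (Node.u j, i) ∈ A

variable (A) in
/-- The elements of `W` joined to the evader in layer `i`. -/
noncomputable def joinedW (i : Fin m) : Finset (Fin (2 * (m - k))) :=
  Finset.univ.filter fun l => (Node.w l, i) ∈ A

theorem layerDeg_ve (hA : Admissible (M S) Node.ve F A) (i : Fin m) :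
    ((M S).addEdges Node.ve A).layerDeg i Node.ve = (joinedU A i).card + (joinedW A i).card := by
  have : (((M S).addEdges Node.ve A).layerGraph i).neighborSet Node.ve =
      Node.u '' (joinedU A i : Set (Fin (3 * k))) ∪
        Node.w '' (joinedW A i : Set (Fin (2 * (m - k)))) := by
    ext z
    rw [SimpleGraph.mem_neighborSet, layerGraph_adj_ve S hA]
    cases z <;> simp [joinedU, joinedW]
    all_goals
      intro h
      have := (hA _ h).1
      simp [F] at this
  rw [MLNet.layerDeg, this, Set.ncard_union_eq,
    Set.ncard_image_of_injective _ fun _ _ h => Node.u.inj h,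
    Set.ncard_image_of_injective _ fun _ _ h => Node.w.inj h,
    Set.ncard_coe_finset, Set.ncard_coe_finset]
  rw [Set.disjoint_left]
  rintro _ ⟨_, -, rfl⟩ ⟨_, -, h⟩
  cases h

/-- A layer meets its safety margin iff the evader has at most two neighbours there, or its
neighbours are exactly the elements of `S i`. -/
theorem three_le_ncard_iff (hS : ∀ i, (S i).card = 3) (hA : Admissible (M S) Node.ve F A)
    (i : Fin m) :
    3 ≤ {z : Node k m | ((M S).addEdges Node.ve A).occ z i ∧
        ((M S).addEdges Node.ve A).layerDeg i Node.ve <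
          ((M S).addEdges Node.ve A).layerDeg i z}.ncard ↔
      (joinedU A i).card + (joinedW A i).card ≤ 2 ∨ joinedU A i = S i ∧ joinedW A i = ∅ := by
  set D := {z : Node k m | ((M S).addEdges Node.ve A).occ z i ∧
        ((M S).addEdges Node.ve A).layerDeg i Node.ve <
          ((M S).addEdges Node.ve A).layerDeg i z}
  constructor
  · intro h3
    by_contra! hcon
    obtain ⟨hd, hne⟩ := hcon
    have hsub : D ⊆ Node.u '' ((S i ∩ joinedU A i : Finset _) : Set (Fin (3 * k))) := by
      rintro z ⟨hocc, hlt⟩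
      rw [layerDeg_ve S hA] at hlt
      cases z with
      | u j =>
        have hj : j ∈ S i := hocc
        rw [layerDeg_u S hA hj] at hlt
        split_ifs at hlt with hjA
        · exact ⟨j, by simp [hj, joinedU, hjA], rfl⟩
        · omega
      | w l => have := layerDeg_w_le_one S (A := A) i l; omega
      | a b => rw [layerDeg_a S hA, hS] at hlt; omega
      | ve => rw [layerDeg_ve S hA] at hlt; omega
    have hcard : 3 ≤ (S i ∩ joinedU A i).card := by
      have := h3.trans (Set.ncard_le_ncard hsub)
      rwa [Set.ncard_image_of_injective _ fun _ _ h => Node.u.inj h, Set.ncard_coe_finset] at this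
    have hSsub : S i ⊆ joinedU A i := by
      rw [← Finset.inter_eq_left]
      exact Finset.eq_of_subset_of_card_le Finset.inter_subset_left (by rw [hS]; exact hcard)
    obtain ⟨z, hz⟩ : D.Nonempty := Set.nonempty_of_ncard_ne_zero (by omega)
    obtain ⟨j, hj, rfl⟩ := hsub hz
    have hlt := hz.2
    have hjS : j ∈ S i := Finset.mem_of_mem_inter_left hj
    rw [layerDeg_ve S hA, layerDeg_u S hA hjS] at hlt
    have h4 : (joinedU A i).card + (joinedW A i).card < 4 := by
      split_ifs at hlt <;> omega
    have hle := Finset.card_le_card hSsub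
    rw [hS] at hle
    have heq := Finset.eq_of_subset_of_card_le hSsub (by rw [hS]; omega)
    exact (hne heq.symm).ne_empty (Finset.card_eq_zero.mp (by omega))
  · rintro (h | ⟨hU, hW⟩)
    · have hsub : Set.range (Node.a : Fin 3 → Node k m) ⊆ D := by
        rintro _ ⟨b, rfl⟩
        refine ⟨trivial, ?_⟩
        rw [layerDeg_ve S hA, layerDeg_a S hA, hS]
        omega
      have := Set.ncard_le_ncard hsub
      rwa [← Set.image_univ, Set.ncard_image_of_injective _ fun _ _ h => Node.a.inj h,
        Set.ncard_univ, Nat.card_fin] at this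
    · have hsub : Node.u '' (S i : Set (Fin (3 * k))) ⊆ D := by
        rintro _ ⟨j, hj, rfl⟩
        refine ⟨hj, ?_⟩
        have hjA : (Node.u j, i) ∈ A := by
          have : j ∈ joinedU A i := hU ▸ hj
          simpa [joinedU] using this
        rw [layerDeg_ve S hA, layerDeg_u S hA hj, if_pos hjA, hU, hW, hS]
        simp
      have := Set.ncard_le_ncard hsub
      rwa [Set.ncard_image_of_injective _ fun _ _ h => Node.u.inj h, Set.ncard_coe_finset,
        hS] at this

end Stmt4

/-- A family of `n` sets of size `c` that covers a type of size `c * n` is pairwise disjoint. -/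
theorem Finset.disjoint_of_cover_of_card {ι α : Type*} [Fintype α] [DecidableEq α]
    [DecidableEq ι] {c : ℕ} {T : Finset ι} {S : ι → Finset α} (hS : ∀ i ∈ T, (S i).card = c)
    (hα : Fintype.card α = c * T.card) (hcover : ∀ x, ∃ i ∈ T, x ∈ S i) :
    ∀ i ∈ T, ∀ j ∈ T, i ≠ j → Disjoint (S i) (S j) := by
  intro i hi j hj hij
  by_contra hdis
  obtain ⟨x, hxi, hxj⟩ := Finset.not_disjoint_iff.mp hdis
  have hsum : ∑ y : α, (T.filter fun i => y ∈ S i).card = ∑ y : α, 1 := by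
    calc ∑ y : α, (T.filter fun i => y ∈ S i).card = ∑ i ∈ T, (S i).card := by
          simp only [Finset.card_eq_sum_ones, Finset.sum_filter]
          rw [Finset.sum_comm]
          simp
      _ = ∑ y : α, 1 := by
          rw [Finset.sum_congr rfl hS]
          simp [hα, mul_comm]
  have hone := (Finset.sum_eq_sum_iff_of_le (s := Finset.univ) (f := fun _ : α => 1)
    (g := fun y => (T.filter fun i => y ∈ S i).card) fun y _ => by
      obtain ⟨i, hi, hy⟩ := hcover y
      exact Finset.card_pos.mpr ⟨i, by simp [hi, hy]⟩).mp hsum.symm x (Finset.mem_univ x)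
  exact hij (Finset.card_le_one.mp hone.symm.le i (by simp [hi, hxi]) j (by simp [hj, hxj]))

/-- The elements of `Fin (2 * n)` can be sent to a set of `n` elements, at most two to each. -/
theorem Finset.exists_map_fiber_card_le_two {ι : Type*} [DecidableEq ι] {n : ℕ} {R : Finset ι}
    (hR : R.card = n) : ∃ g : Fin (2 * n) → ι, (∀ l, g l ∈ R) ∧
      ∀ i, (Finset.univ.filter fun l => g l = i).card ≤ 2 := by
  let e := R.equivFinOfCardEq hR
  refine ⟨fun l => e.symm ⟨l / 2, by omega⟩, fun l => (e.symm _).2, fun i => ?_⟩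
  have : (Finset.univ.filter fun l : Fin (2 * n) =>
      (e.symm ⟨l / 2, by omega⟩ : ι) = i).card ≤ (Finset.range 2).card := by
    refine Finset.card_le_card_of_injOn (fun l => (l : ℕ) % 2)
      (fun l _ => Finset.mem_coe.mpr (Finset.mem_range.mpr (Nat.mod_lt _ two_pos)))
      fun l hl l' hl' h => ?_
    simp only [Finset.coe_filter, Finset.mem_univ, true_and, Set.mem_ofPred_eq] at hl hl' h
    have := e.symm.injective (Subtype.ext (hl.trans hl'.symm))
    rw [Fin.mk.injEq] at this
    omega
  simpa using this

namespace Stmt4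

variable {k m : ℕ} {S : Fin m → Finset (Fin (3 * k))}

theorem exists_admissible_of_exactCover {T : Finset (Fin m)} (hT : T.card = k)
    (hcover : ∀ x, ∃ i ∈ T, x ∈ S i) :
    ∃ A : Set (Node k m × Fin m), Admissible (M S) Node.ve F A ∧ ConnectsAll F A ∧
      ∀ i, (joinedU A i).card + (joinedW A i).card ≤ 2 ∨
        joinedU A i = S i ∧ joinedW A i = ∅ := by
  obtain ⟨g, hgT, hg⟩ := Finset.exists_map_fiber_card_le_two (R := Tᶜ) (n := m - k)
    (by rw [Finset.card_compl, hT, Fintype.card_fin])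
  refine ⟨{p | (∃ j, p.1 = Node.u j ∧ p.2 ∈ T ∧ j ∈ S p.2) ∨ ∃ l, p.1 = Node.w l ∧ g l = p.2},
    ?_, ?_, fun i => ?_⟩
  · rintro ⟨z, i⟩ (⟨j, rfl, -, hj⟩ | ⟨l, rfl, -⟩)
    · exact ⟨Or.inl ⟨j, rfl⟩, trivial, hj⟩
    · exact ⟨Or.inr ⟨l, rfl⟩, trivial, trivial⟩
  · rintro _ (⟨j, rfl⟩ | ⟨l, rfl⟩)
    · obtain ⟨i, hi, hj⟩ := hcover j
      exact ⟨i, Or.inl ⟨j, rfl, hi, hj⟩⟩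
    · exact ⟨g l, Or.inr ⟨l, rfl, rfl⟩⟩
  · by_cases hi : i ∈ T
    · right
      refine ⟨by ext j; simp [joinedU, hi], ?_⟩
      ext l
      have := Finset.mem_compl.mp (hgT l)
      suffices g l ≠ i by simpa [joinedW] using this
      rintro rfl
      exact this hi
    · left
      simpa [joinedU, joinedW, hi] using hg i

theorem exists_exactCover_of_layers (hkm : k ≤ m) (hS : ∀ i, (S i).card = 3)
    {P : Fin m → Finset (Fin (3 * k))} {Q : Fin m → Finset (Fin (2 * (m - k)))}
    (hP : ∀ j, ∃ i, j ∈ P i) (hQ : ∀ l, ∃ i, l ∈ Q i)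
    (h : ∀ i, (P i).card + (Q i).card ≤ 2 ∨ P i = S i ∧ Q i = ∅) :
    ∃ T : Finset (Fin m), T.card = k ∧ ∀ x, ∃ i ∈ T, x ∈ S i := by
  let T := Finset.univ.filter fun i => P i = S i ∧ Q i = ∅
  have hT : ∀ i ∈ T, P i = S i ∧ Q i = ∅ := fun i hi => (Finset.mem_filter.mp hi).2
  have hcompl : ∑ i ∈ Tᶜ, (P i).card + ∑ i ∈ Tᶜ, (Q i).card ≤ Tᶜ.card * 2 := by
    rw [← Finset.sum_add_distrib]
    refine Finset.sum_le_card_nsmul _ _ _ fun i hi => (h i).resolve_right fun hi' => ?_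
    exact Finset.mem_compl.mp hi (Finset.mem_filter.mpr ⟨Finset.mem_univ i, hi'⟩)
  have hW : 2 * (m - k) ≤ ∑ i ∈ Tᶜ, (Q i).card := by
    have huniv : Tᶜ.biUnion Q = Finset.univ := by
      refine Finset.eq_univ_of_forall fun l => ?_
      obtain ⟨i, hi⟩ := hQ l
      refine Finset.mem_biUnion.mpr ⟨i, Finset.mem_compl.mpr fun hiT => ?_, hi⟩
      simp [(hT i hiT).2] at hi
    simpa [huniv] using Finset.card_biUnion_le (s := Tᶜ) (t := Q)
  have hU : 3 * k ≤ ∑ i ∈ T, (P i).card + ∑ i ∈ Tᶜ, (P i).card := by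
    have huniv : Finset.univ.biUnion P = Finset.univ :=
      Finset.eq_univ_of_forall fun j => by simpa using hP j
    rw [Finset.sum_add_sum_compl]
    simpa [huniv] using Finset.card_biUnion_le (s := Finset.univ) (t := P)
  have hTsum : ∑ i ∈ T, (P i).card = T.card * 3 :=
    Finset.sum_const_nat fun i hi => by rw [(hT i hi).1, hS]
  have hTc : Tᶜ.card + T.card = m := by
    rw [Finset.card_compl_add_card, Fintype.card_fin]
  have hzero : ∑ i ∈ Tᶜ, (P i).card = 0 := by omega
  refine ⟨T, by omega, fun x => ?_⟩
  obtain ⟨i, hi⟩ := hP x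
  have hiT : i ∈ T := by
    by_contra hiT
    have := Finset.sum_eq_zero_iff.mp hzero i (Finset.mem_compl.mpr hiT)
    simp [Finset.card_eq_zero.mp this] at hi
  exact ⟨i, hiT, (hT i hiT).1 ▸ hi⟩

end Stmt4

/-- **Theorem: Multilayer Local Hiding is NP-complete for degree centrality.**
The Exact 3-Set Cover instance `(U, S)` has a solution iff the constructed instance of
Multilayer Local Hiding with degree centrality and safety margins `d^{αᵢ} = 3` has a
solution. -/
theorem local_degree_hiding_reduction (k m : ℕ) (hk : 1 ≤ k) (hkm : k ≤ m)
    (S : Fin m → Finset (Fin (3 * k))) (hS : ∀ i, (S i).card = 3) :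
    (∃ T : Finset (Fin m), T.card = k ∧
        (∀ i ∈ T, ∀ j ∈ T, i ≠ j → Disjoint (S i) (S j)) ∧
        (∀ x : Fin (3 * k), ∃ i ∈ T, x ∈ S i))
    ↔ (∃ A : Set (Stmt4.Node k m × Fin m),
        Admissible (Stmt4.M S) Stmt4.Node.ve Stmt4.F A ∧
        ConnectsAll Stmt4.F A ∧
        ∀ i : Fin m,
          3 ≤ {z : Stmt4.Node k m | ((Stmt4.M S).addEdges Stmt4.Node.ve A).occ z i ∧
            ((Stmt4.M S).addEdges Stmt4.Node.ve A).layerDeg i Stmt4.Node.ve <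
            ((Stmt4.M S).addEdges Stmt4.Node.ve A).layerDeg i z}.ncard) := by
  constructor
  · rintro ⟨T, hT, -, hcover⟩
    obtain ⟨A, hA, hconn, h⟩ := Stmt4.exists_admissible_of_exactCover hT hcover
    exact ⟨A, hA, hconn, fun i => (Stmt4.three_le_ncard_iff S hS hA i).mpr (h i)⟩
  · rintro ⟨A, hA, hconn, h⟩
    obtain ⟨T, hT, hcover⟩ := Stmt4.exists_exactCover_of_layers hkm hS
      (P := Stmt4.joinedU A) (Q := Stmt4.joinedW A)
      (fun j => by simpa [Stmt4.joinedU] using hconn (.u j) (Or.inl ⟨j, rfl⟩))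
      (fun l => by simpa [Stmt4.joinedW] using hconn (.w l) (Or.inr ⟨l, rfl⟩))
      fun i => (Stmt4.three_le_ncard_iff S hS hA i).mp (h i)
    exact ⟨T, hT, Finset.disjoint_of_cover_of_card (fun i _ => hS i) (by simp [hT]) hcover,
      hcover⟩
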